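/- Let p be a prime, let V ⊆ ℂ^ℕ be a finite-dimensional ℂ-subspace spanned by its integer points, and let S ⊆ ℕ with restriction map π_S : ℂ^ℕ → ℂ^S. Let W = π_S(V) ⊆ ℂ^S, and let W_p ⊆ 𝔽_p^S be the image of W ∩ ℤ^S under coordinatewise reduction modulo p. Then dim_ℂ W = dim_{𝔽_p} W_p. -/

import Mathlib

theorem linearIndependent_intCast {S ι : Type*} {b : ι → S → ℤ} (hb : LinearIndependent ℤ b) :
    LinearIndependent ℂ (fun i s => (b i s : ℂ)) := by
  have hQ : LinearIndependent ℚ (fun i s => (b i s : ℚ)) := by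
    rw [← LinearIndependent.iff_fractionRing ℤ ℚ]
    let c : (S → ℤ) →ₗ[ℤ] (S → ℚ) := (Algebra.linearMap ℤ ℚ).compLeft S
    refine hb.map' c (LinearMap.ker_eq_bot.2 fun x y h => ?_)
    ext s
    simpa [c] using congrFun h s
  rw [linearIndependent_iff'] at hQ ⊢
  intro t g hg i hi
  refine (Module.forall_dual_apply_eq_zero_iff ℚ (g i)).1 fun φ => ?_
  refine hQ t (fun j => φ (g j)) ?_ i hi
  ext s
  have h := congrArg φ (congrFun hg s)
  simp only [Finset.sum_apply, Pi.smul_apply, smul_eq_mul, map_sum, Pi.zero_apply, map_zero] at h ⊢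
  rw [← h]
  refine Finset.sum_congr rfl fun j _ => ?_
  rw [mul_comm (g j), ← zsmul_eq_mul, map_zsmul, zsmul_eq_mul, mul_comm]

theorem exists_finset_eq_zero_of_forall_mem {K S : Type*} [Field K] (W : Submodule K (S → K))
    [FiniteDimensional K W] :
    ∃ T : Finset S, ∀ w ∈ W, (∀ s ∈ T, w s = 0) → w = 0 := by
  let N : Finset S → Submodule K W := fun T =>
    T.inf fun s => LinearMap.ker (LinearMap.proj s ∘ₗ W.subtype)
  have hN (T) (w : W) : w ∈ N T ↔ ∀ s ∈ T, (w : S → K) s = 0 := by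
    simp [N, Submodule.mem_finsetInf]
  obtain ⟨_, ⟨T, rfl⟩, hT⟩ := IsArtinian.set_has_minimal (Set.range N) ⟨_, ∅, rfl⟩
  classical
  refine ⟨T, fun w hw h => funext fun s => by_contra fun hs => ?_⟩
  refine hT (N (insert s T)) ⟨_, rfl⟩ (SetLike.lt_iff_le_and_exists.2 ⟨fun x hx => ?_,
    ⟨w, hw⟩, (hN _ _).2 h, fun hw' => hs ((hN _ _).1 hw' s (by simp))⟩)
  rw [hN] at hx ⊢
  exact fun s hs => hx s (by simp [hs])

/-- The lattice of integer points of a complex subspace of `ℂ^S`. -/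
def integerPoints {S : Type*} (W : Submodule ℂ (S → ℂ)) : Submodule ℤ (S → ℤ) :=
  (W.restrictScalars ℤ).comap ((Algebra.linearMap ℤ ℂ).compLeft S)

theorem mem_integerPoints {S : Type*} {W : Submodule ℂ (S → ℂ)} {f : S → ℤ} :
    f ∈ integerPoints W ↔ (fun s => (f s : ℂ)) ∈ W := Iff.rfl

theorem exists_basis_integerPoints {S : Type*} (W : Submodule ℂ (S → ℂ))
    [FiniteDimensional ℂ W] : ∃ n : ℕ, Nonempty (Module.Basis (Fin n) ℤ (integerPoints W)) := by
  obtain ⟨T, hT⟩ := exists_finset_eq_zero_of_forall_mem W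
  let r : integerPoints W →ₗ[ℤ] (T → ℤ) :=
    LinearMap.funLeft ℤ ℤ ((↑) : T → S) ∘ₗ (integerPoints W).subtype
  have hr : Function.Injective r := by
    refine LinearMap.ker_eq_bot.1 (LinearMap.ker_eq_bot'.2 fun f hf => ?_)
    have h := hT _ (mem_integerPoints.1 f.2) fun s hs => by
      simpa [r] using congrFun hf ⟨s, hs⟩
    ext s
    simpa using congrFun h s
  have : Module.Finite ℤ (integerPoints W) := Module.Finite.of_injective r hr
  exact ⟨_, ⟨Module.finBasis ℤ _⟩⟩

theorem linearIndependent_reduction {S ι : Type*} [Fintype ι] {p : ℕ} (hp : p.Prime)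
    {W : Submodule ℂ (S → ℂ)} (b : Module.Basis ι ℤ (integerPoints W)) :
    LinearIndependent (ZMod p) (fun i s => ((b i : S → ℤ) s : ZMod p)) := by
  rw [Fintype.linearIndependent_iff]
  intro g hg i
  choose c hc using fun i => ZMod.intCast_surjective (g i)
  have hdvd : ∀ s, ∃ m : ℤ, ∑ i, c i * (b i : S → ℤ) s = p * m := fun s => by
    refine (ZMod.intCast_zmod_eq_zero_iff_dvd _ p).1 ?_
    simpa [hc] using congrFun hg s
  choose f hf using hdvd
  have hsum : ((∑ i, c i • b i : integerPoints W) : S → ℤ) = (p : ℤ) • f := by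
    ext s
    simpa using hf s
  have hfW : f ∈ integerPoints W := by
    have h := mem_integerPoints.1 (∑ i, c i • b i : integerPoints W).2
    rw [hsum] at h
    refine mem_integerPoints.2 ((W.smul_mem_iff (Nat.cast_ne_zero.2 hp.ne_zero : (p : ℂ) ≠ 0)).1 ?_)
    convert h using 1
    ext s
    simp
  have heq : ∑ i, c i • b i = (p : ℤ) • (⟨f, hfW⟩ : integerPoints W) := Subtype.ext hsum
  have h := congrArg (fun x => b.repr x i) heq
  simp only [b.repr_sum_self, map_smul, Finsupp.smul_apply, smul_eq_mul] at h
  rw [← hc i, h]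
  simp

/-- The image in `R^S` of a point of a lattice lies in the `R`-span of the images of a basis. -/
theorem intCast_mem_span_basis {S ι R : Type*} [Fintype ι] [CommRing R]
    {L : Submodule ℤ (S → ℤ)} (b : Module.Basis ι ℤ L) {f : S → ℤ} (hf : f ∈ L) :
    (fun s => (f s : R)) ∈ Submodule.span R (Set.range fun i s => ((b i : S → ℤ) s : R)) := by
  rw [Submodule.mem_span_range_iff_exists_fun]
  refine ⟨fun i => (b.repr ⟨f, hf⟩ i : R), ?_⟩
  ext s
  have h := congrArg (fun x : L => (x : S → ℤ) s) (b.sum_repr ⟨f, hf⟩)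
  simp only [Submodule.coe_sum, Submodule.coe_smul, Finset.sum_apply, Pi.smul_apply,
    smul_eq_mul] at h
  simp [← h]

theorem linearIndependent_coe_basis {R M ι : Type*} [Ring R] [AddCommGroup M] [Module R M]
    {L : Submodule R M} (b : Module.Basis ι R L) : LinearIndependent R fun i => (b i : M) :=
  b.linearIndependent.map' L.subtype L.ker_subtype

/-- Let `p` be a prime, `V ⊆ ℂ^ℕ` a finite-dimensional ℂ-subspace
spanned by its integer points, and `S ⊆ ℕ` with restriction map `π_S`.  Let
`W = π_S(V) ⊆ ℂ^S`, and let `Wp ⊆ 𝔽_p^S` be the image of `W ∩ ℤ^S` under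
coordinatewise reduction modulo `p`.  Then `dim_ℂ W = dim_{𝔽_p} Wp`. -/
theorem finrank_image_eq_finrank_image_reduction
    (p : ℕ) (hp : p.Prime)
    (V : Submodule ℂ (ℕ → ℂ)) (hVfin : FiniteDimensional ℂ V)
    (hVspan : V = Submodule.span ℂ
      {v : ℕ → ℂ | v ∈ V ∧ ∀ n : ℕ, ∃ m : ℤ, v n = (m : ℂ)})
    (S : Set ℕ)
    (W : Submodule ℂ (S → ℂ))
    (hW : W = V.map (LinearMap.funLeft ℂ ℂ ((↑) : S → ℕ)))
    (Wp : Submodule (ZMod p) (S → ZMod p))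
    (hWp : (Wp : Set (S → ZMod p)) =
      {w : S → ZMod p | ∃ f : S → ℤ,
        (fun s : S => (f s : ℂ)) ∈ W ∧ w = fun s : S => ((f s : ZMod p))}) :
    Module.finrank ℂ W = Module.finrank (ZMod p) Wp := by
  have : FiniteDimensional ℂ W := by
    rw [hW]
    infer_instance
  have hspan : W ≤ Submodule.span ℂ {w | w ∈ W ∧ ∃ f : S → ℤ, w = fun s => (f s : ℂ)} := by
    conv_lhs => rw [hW, hVspan, Submodule.map_span]
    refine Submodule.span_mono ?_
    rintro _ ⟨v, ⟨hv, hint⟩, rfl⟩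
    choose f hf using hint
    exact ⟨by rw [hW]; exact Submodule.mem_map_of_mem hv, fun s => f s, funext fun s => hf s⟩
  obtain ⟨n, ⟨b⟩⟩ := exists_basis_integerPoints W
  have hb := linearIndependent_coe_basis b
  have : Fact p.Prime := ⟨hp⟩
  have hWeq : W = Submodule.span ℂ (Set.range fun i s => ((b i : S → ℤ) s : ℂ)) := by
    refine le_antisymm (hspan.trans (Submodule.span_le.2 ?_)) (Submodule.span_le.2 ?_)
    · rintro _ ⟨hw, f, rfl⟩
      exact intCast_mem_span_basis b (mem_integerPoints.2 hw)
    · rintro _ ⟨i, rfl⟩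
      exact mem_integerPoints.1 (b i).2
  have hWpeq : Wp = Submodule.span (ZMod p)
      (Set.range fun i s => ((b i : S → ℤ) s : ZMod p)) := by
    have hmem (w) : w ∈ Wp ↔ ∃ f : S → ℤ, (fun s : S => (f s : ℂ)) ∈ W ∧
        w = fun s : S => ((f s : ZMod p)) := by
      rw [← SetLike.mem_coe, hWp, Set.mem_ofPred_eq]
    refine le_antisymm (fun w hw => ?_) (Submodule.span_le.2 ?_)
    · obtain ⟨f, hf, rfl⟩ := (hmem w).1 hw
      exact intCast_mem_span_basis b (mem_integerPoints.2 hf)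
    · rintro _ ⟨i, rfl⟩
      exact (hmem _).2 ⟨b i, mem_integerPoints.1 (b i).2, rfl⟩
  have hdimW := finrank_span_eq_card (linearIndependent_intCast hb)
  have hdimWp := finrank_span_eq_card (linearIndependent_reduction hp b)
  rw [← hWeq] at hdimW
  rw [← hWpeq] at hdimWp
  exact hdimW.trans hdimWp.symm
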